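/- For every positive integer n and every nonnegative integer j, the sum of w(π) over all overpartitions π ∈ EO̅* with |π| = n and o(π) = j equals the number of quadruples (α, β, γ, δ) of partitions with |α| + |β| + |γ| + |δ| = n, where α is a partition into distinct parts all divisible by 4, β and γ are partitions into distinct parts congruent to 4 modulo 8 with the total number of parts of β and γ equal to j, and δ is a partition into parts congruent to 4 modulo 8. -/

import Mathlib

/-- A partition is a finite multiset of positive integers. -/
def IsPartition (m : Multiset ℕ) : Prop := ∀ x ∈ m, 0 < x

/-- The largest even part of a partition (0 if there are no even parts). -/
def lep (m : Multiset ℕ) : ℕ := (m.filter (fun x => Even x)).sup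

/-- `EO*`: every even part is smaller than every odd part, every part other than the
largest even part appears an even number of times, and the largest even part appears
an odd number of times. -/
def EOStar (m : Multiset ℕ) : Prop :=
  IsPartition m ∧
  (∀ x ∈ m, ∀ y ∈ m, Even x → Odd y → x < y) ∧
  (∀ x ∈ m, x ≠ lep m → Even (m.count x)) ∧
  (∀ x ∈ m, x = lep m → Odd (m.count x))

/-- `E*`: partitions into even parts where each distinct part appears an even number of times. -/
def EStar (m : Multiset ℕ) : Prop :=
  IsPartition m ∧ (∀ x ∈ m, Even x) ∧ ∀ x : ℕ, Even (m.count x)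

/-- `O_k*`: partitions into odd parts with exactly `2k` parts where each distinct part
appears an even number of times. -/
def OStar (k : ℕ) (m : Multiset ℕ) : Prop :=
  IsPartition m ∧ (∀ x ∈ m, Odd x) ∧ Multiset.card m = 2 * k ∧ ∀ x : ℕ, Even (m.count x)

/-- `Q_{k,r}`: partitions with a `(k+r+1) × k` Durfee rectangle whose largest part below
the rectangle is `< k+r+1`; equivalently, exactly `k` parts are `≥ k+r+1`. -/
def QSet (k r : ℕ) (m : Multiset ℕ) : Prop :=
  IsPartition m ∧ Multiset.card (m.filter (fun x => k + r + 1 ≤ x)) = k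

/-- `EO*_{k,r}`: partitions in `EO*` with exactly `2k` odd parts and largest even part `2k+2r`. -/
def EOkr (k r : ℕ) (m : Multiset ℕ) : Prop :=
  EOStar m ∧ Multiset.card (m.filter (fun x => Odd x)) = 2 * k ∧ lep m = 2 * k + 2 * r

/-- The even-odd crank: largest even part minus the number of odd parts. -/
def eoc (m : Multiset ℕ) : ℤ :=
  (lep m : ℤ) - (Multiset.card (m.filter (fun x => Odd x)) : ℤ)

/-- The conjugate partition: its `i`-th part is the number of parts that are `≥ i`. -/
def conjugate (m : Multiset ℕ) : Multiset ℕ :=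
  (Multiset.range m.sup).map (fun i => Multiset.card (m.filter (fun x => i + 1 ≤ x)))

/-- An overpartition: a partition together with a set of overlined part values, which must
be a subset of the distinct part values. -/
def IsOverpartition (p : Multiset ℕ × Finset ℕ) : Prop :=
  IsPartition p.1 ∧ p.2 ⊆ p.1.toFinset


/-- `EO̅*`: overpartitions in which every even part is below every odd part and only the
largest even part appears an odd number of times (overlined and non-overlined occurrences
counted together). -/
def OverEOStar (p : Multiset ℕ × Finset ℕ) : Prop :=
  IsOverpartition p ∧
  (∀ x ∈ p.1, ∀ y ∈ p.1, Even x → Odd y → x < y) ∧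
  (∀ x ∈ p.1, x ≠ lep p.1 → Even (p.1.count x)) ∧
  (∀ x ∈ p.1, x = lep p.1 → Odd (p.1.count x))

namespace BaileyDaum

open Finset

variable {A : Type*} [CommRing A]

/-- The product `∏_{i < M} (1 + z q^{2(m+i)+1})`. -/
def oddTail (M : ℕ) (q z : A) (m : ℕ) : A :=
  ∏ i ∈ range M, (1 + z * q ^ (2 * (m + i) + 1))

/-- The product `∏_{i < M} g (2(m+i)+1)`. -/
def oddTailInv (M : ℕ) (g : ℕ → A) (m : ℕ) : A :=
  ∏ i ∈ range M, g (2 * (m + i) + 1)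

/-- The `m`-th summand of the truncated Bailey–Daum series, where `g k` stands for the inverse
of `1 - q ^ k`. -/
def term (M : ℕ) (q : A) (g : ℕ → A) (z : A) (m : ℕ) : A :=
  (-q) ^ m * (∏ i ∈ range m, (1 + z * q ^ (2 * i))) * (∏ i ∈ range m, g (2 * i + 2)) *
    oddTail M q z m * oddTailInv M g m

variable {M : ℕ} {q : A} {g : ℕ → A}

theorem term_succ (z : A) (m : ℕ) :
    term M q g z (m + 1) = (-1) ^ (m + 1) * (oddTail M q z (m + 1) * oddTailInv M g (m + 1) *
      ((∏ k ∈ range m, (1 + z * q ^ (2 * k + 2))) * (∏ k ∈ range m, g (2 * k + 2)) *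
        (1 + (1 + z) * q ^ (m + 1) * g (2 * (m + 1)))) -
      oddTail M q z (m + 1) * oddTailInv M g (m + 1) *
      ((∏ k ∈ range m, (1 + z * q ^ (2 * k + 2))) * ∏ k ∈ range m, g (2 * k + 2))) := by
  rw [term, prod_range_succ' (fun i ↦ 1 + z * q ^ (2 * i)), prod_range_succ, neg_pow]
  simp only [mul_add, mul_one, mul_zero, pow_zero]
  ring

theorem inv_eq_one (hq : q ^ M = 0) (hg : ∀ k, 1 ≤ k → (1 - q ^ k) * g k = 1) {k : ℕ}
    (hk : 1 ≤ k) (h : M ≤ k) : g k = 1 := by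
  simpa [pow_eq_zero_of_le h hq] using hg k hk

theorem oddTail_eq (hq : q ^ M = 0) (z : A) (m : ℕ) :
    oddTail M q z m = (1 + z * q ^ (2 * m + 1)) * oddTail M q z (m + 1) := by
  have h := prod_range_succ (fun i ↦ 1 + z * q ^ (2 * (m + i) + 1)) M
  rw [prod_range_succ', pow_eq_zero_of_le (n := 2 * (m + M) + 1) (by lia) hq] at h
  simp only [oddTail]
  simp only [mul_zero, add_zero, mul_one] at h
  rw [← h, mul_comm]
  congr 1
  refine prod_congr rfl fun i _ ↦ ?_
  ring_nf

theorem oddTailInv_eq (hq : q ^ M = 0) (hg : ∀ k, 1 ≤ k → (1 - q ^ k) * g k = 1) (m : ℕ) :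
    oddTailInv M g m = g (2 * m + 1) * oddTailInv M g (m + 1) := by
  have h := prod_range_succ (fun i ↦ g (2 * (m + i) + 1)) M
  rw [prod_range_succ', inv_eq_one hq hg (k := 2 * (m + M) + 1) (by lia) (by lia)] at h
  simp only [oddTailInv]
  rw [mul_one] at h
  rw [← h, mul_comm]
  congr 1
  refine prod_congr rfl fun i _ ↦ ?_
  ring_nf

theorem oddTail_shift (z : A) (m : ℕ) : oddTail M q (z * q ^ 4) m = oddTail M q z (m + 2) := by
  refine prod_congr rfl fun i _ ↦ ?_
  ring

theorem telescope (hq : q ^ M = 0) (hg : ∀ k, 1 ≤ k → (1 - q ^ k) * g k = 1) (z : A) (k : ℕ) :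
    ∑ m ∈ range (k + 1), (term M q g z m - (1 + z * q ^ 2) ^ 2 * term M q g (z * q ^ 4) m) =
      -z * (1 - q) * (-q) ^ (k + 1) * (∏ i ∈ range k, (1 + z * q ^ (2 * i + 2))) *
        (∏ i ∈ range k, g (2 * i + 2)) * oddTail M q z (k + 2) * oddTailInv M g (k + 1) := by
  induction k with
  | zero =>
    have h1 := hg 1 le_rfl
    simp only [term, oddTail_shift, zero_add, range_one, sum_singleton, range_zero, prod_empty]
    rw [oddTail_eq hq z 0, oddTail_eq hq z (0 + 1), oddTailInv_eq hq hg 0]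
    simp only [mul_zero, zero_add, pow_one, pow_zero, mul_one, one_mul] at h1 ⊢
    norm_num
    linear_combination (z * q * (1 - q) * oddTail M q z 2 * oddTailInv M g 1) * h1
  | succ k ih =>
    rw [sum_range_succ, ih]
    have ha := hg (2 * k + 2) (by lia)
    have hb := hg (2 * (k + 1) + 1) (by lia)
    have e1 : ∏ i ∈ range (k + 1), (1 + z * q ^ (2 * i)) =
        (1 + z) * ∏ i ∈ range k, (1 + z * q ^ (2 * i + 2)) := by
      rw [prod_range_succ', mul_comm]
      simp [mul_add]
    have e2 : (1 + z * q ^ 2) * ∏ i ∈ range (k + 1), (1 + z * q ^ 4 * q ^ (2 * i)) =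
        (∏ i ∈ range k, (1 + z * q ^ (2 * i + 2))) * (1 + z * q ^ (2 * k + 2)) *
          (1 + z * q ^ (2 * (k + 1) + 2)) := by
      rw [← prod_range_succ (fun i ↦ 1 + z * q ^ (2 * i + 2)),
        ← prod_range_succ (fun i ↦ 1 + z * q ^ (2 * i + 2)), prod_range_succ' _ (k + 1), mul_comm]
      congr 1
      refine prod_congr rfl fun i _ ↦ ?_
      ring
    simp only [term, oddTail_shift]
    rw [e1, prod_range_succ (fun i ↦ g (2 * i + 2)), 
      prod_range_succ (fun i ↦ 1 + z * q ^ (2 * i + 2)) k, oddTail_eq hq z (k + 1),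
      oddTailInv_eq hq hg (k + 1)]
    generalize ∏ i ∈ range k, (1 + z * q ^ (2 * i + 2)) = U at *
    generalize ∏ i ∈ range (k + 1), (1 + z * q ^ 4 * q ^ (2 * i)) = V at *
    generalize ∏ i ∈ range k, g (2 * i + 2) = J at *
    generalize g (2 * k + 2) = a at *
    generalize g (2 * (k + 1) + 1) = b at *
    generalize oddTailInv M g (k + 1 + 1) = I at *
    have e3 : oddTail M q z (k + 2) = oddTail M q z (k + 1 + 1) := rfl
    have e4 : oddTail M q z (k + 1 + 2) = oddTail M q z (k + 1 + 1 + 1) := rfl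
    rw [e3, e4, oddTail_eq hq z (k + 1 + 1)]
    generalize oddTail M q z (k + 1 + 1 + 1) = T at *
    have p1 : q ^ (2 * (k + 1) + 1) = q ^ (2 * k + 2) * q := by ring
    have p2 : q ^ (2 * (k + 1 + 1) + 1) = q ^ (2 * k + 2) * q ^ 3 := by ring
    have p3 : q ^ (2 * (k + 1) + 2) = q ^ (2 * k + 2) * q ^ 2 := by ring
    rw [p1] at hb
    rw [p3] at e2
    rw [p1, p2, pow_succ (-q) (k + 1)]
    generalize q ^ (2 * k + 2) = u at *
    generalize (-q) ^ (k + 1) = Y at *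
    linear_combination (-(1 + z * q ^ 2) * Y * J * a * T * b * I) * e2 +
      (z * (1 - q) * (1 + z * (u * q ^ 3)) * Y * U * J * T * b * I) * ha +
      (z * (1 - q) * q * (1 + z * u) * Y * U * J * T * a * I) * hb

/-- The truncated Bailey–Daum series. -/
def series (M : ℕ) (q : A) (g : ℕ → A) (z : A) : A := ∑ m ∈ range M, term M q g z m

theorem series_eq_mul (hq : q ^ M = 0) (hg : ∀ k, 1 ≤ k → (1 - q ^ k) * g k = 1) (z : A) :
    series M q g z = (1 + z * q ^ 2) ^ 2 * series M q g (z * q ^ 4) := by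
  rw [← sub_eq_zero, series, series, mul_sum, ← sum_sub_distrib]
  rcases M with - | M
  · simp
  · rw [telescope hq hg, neg_pow, hq]
    ring

theorem series_eq_prod_mul (hq : q ^ M = 0) (hg : ∀ k, 1 ≤ k → (1 - q ^ k) * g k = 1) (z : A)
    (N : ℕ) :
    series M q g z =
      (∏ i ∈ range N, (1 + z * q ^ (4 * i + 2))) ^ 2 * series M q g (z * q ^ (4 * N)) := by
  induction N with
  | zero => simp
  | succ N ih =>
    rw [ih, series_eq_mul hq hg, prod_range_succ]
    ring_nf

theorem series_neg_one (hM : M ≠ 0) (hg : ∀ k, 1 ≤ k → (1 - q ^ k) * g k = 1) :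
    series M q g (-1) = 1 := by
  obtain ⟨M, rfl⟩ := Nat.exists_eq_succ_of_ne_zero hM
  rw [series, sum_range_succ', sum_eq_zero, zero_add]
  · simp only [term, oddTail, oddTailInv, range_zero, prod_empty, pow_zero, one_mul]
    rw [← prod_mul_distrib]
    refine prod_eq_one fun i _ ↦ ?_
    rw [neg_one_mul, ← sub_eq_add_neg, hg _ (by lia)]
  · intro m _
    simp [term, prod_range_succ']

theorem prod_range_two_mul {B : Type*} [CommMonoid B] (f : ℕ → B) (n : ℕ) :
    ∏ i ∈ range (2 * n), f i = ∏ i ∈ range n, (f (2 * i) * f (2 * i + 1)) := by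
  induction n with
  | zero => simp
  | succ n ih => rw [mul_add, prod_range_succ, prod_range_succ, ih, prod_range_succ, mul_assoc]

/-- Euler's identity between distinct parts and odd parts, truncated. -/
theorem euler {L : ℕ} (hq : q ^ (4 * L) = 0) (hg : ∀ k, 1 ≤ k → (1 - q ^ k) * g k = 1) :
    (∏ i ∈ range (2 * L), (1 + q ^ (2 * i + 2))) * ∏ i ∈ range L, (1 - q ^ (4 * i + 2)) = 1 := by
  have h1 : (∏ i ∈ range (2 * L), (1 + q ^ (2 * i + 2))) *
      ∏ i ∈ range (2 * L), (1 - q ^ (2 * i + 2)) = ∏ i ∈ range L, (1 - q ^ (4 * i + 4)) := by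
    rw [← prod_mul_distrib, two_mul, prod_range_add]
    conv_rhs => rw [← mul_one (∏ i ∈ range L, _)]
    congr 1
    · refine prod_congr rfl fun i _ ↦ ?_
      ring
    · refine prod_eq_one fun i _ ↦ ?_
      have : (q ^ (2 * (L + i) + 2)) ^ 2 = 0 := by
        rw [← pow_mul]
        exact pow_eq_zero_of_le (by lia) hq
      linear_combination -this
  rw [prod_range_two_mul (fun i ↦ 1 - q ^ (2 * i + 2)), prod_mul_distrib] at h1
  have h2 : (∏ i ∈ range L, (1 - q ^ (4 * i + 4))) * ∏ i ∈ range L, g (4 * i + 4) = 1 := by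
    rw [← prod_mul_distrib]
    exact prod_eq_one fun i _ ↦ hg _ (by lia)
  simp only [← mul_assoc, mul_add, mul_one] at h1
  norm_num [add_assoc] at h1
  linear_combination (∏ i ∈ range L, g (4 * i + 4)) * h1 + (1 - (∏ i ∈ range (2 * L),
    (1 + q ^ (2 * i + 2))) * ∏ i ∈ range L, (1 - q ^ (4 * i + 2))) * h2

/-- The Bailey–Daum summation in a ring where `q` is nilpotent. -/
theorem series_eq {L : ℕ} (hL : L ≠ 0) (hq : q ^ (4 * L) = 0)
    (hg : ∀ k, 1 ≤ k → (1 - q ^ k) * g k = 1) (z : A) :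
    series (4 * L) q g z = (∏ i ∈ range (2 * L), (1 + q ^ (2 * i + 2))) *
      (∏ i ∈ range L, (1 + z * q ^ (4 * i + 2))) ^ 2 * ∏ i ∈ range L, g (4 * i + 2) := by
  have h1 := series_eq_prod_mul hq hg z L
  have h2 := series_eq_prod_mul hq hg (-1) L
  rw [hq, mul_zero] at h1 h2
  rw [series_neg_one (by lia) hg] at h2
  simp only [neg_one_mul, ← sub_eq_add_neg] at h2
  have h3 := euler hq hg
  have h4 : (∏ i ∈ range L, (1 - q ^ (4 * i + 2))) * ∏ i ∈ range L, g (4 * i + 2) = 1 := by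
    rw [← prod_mul_distrib]
    exact prod_eq_one fun i _ ↦ hg _ (by lia)
  rw [h1]
  generalize (∏ i ∈ range L, (1 - q ^ (4 * i + 2))) = O at *
  generalize (∏ i ∈ range (2 * L), (1 + q ^ (2 * i + 2))) = D at *
  generalize ∏ i ∈ range L, g (4 * i + 2) = I at *
  generalize series (4 * L) q g 0 = S at *
  have hS : S = D * I := by
    linear_combination (-S) * h3 - S * D * O * h4 - D * I * h2
  rw [hS]
  ring

end BaileyDaum

namespace PartitionGF

open Finset PowerSeries

/-- The partitions of `n`, as a finset of multisets. -/
def partitions (n : ℕ) : Finset (Multiset ℕ) :=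
  univ.image (Nat.Partition.parts (n := n))

theorem mem_partitions {n : ℕ} {m : Multiset ℕ} :
    m ∈ partitions n ↔ IsPartition m ∧ m.sum = n := by
  simp only [partitions, mem_image, mem_univ, true_and, IsPartition]
  constructor
  · rintro ⟨p, rfl⟩
    exact ⟨fun x hx ↦ p.parts_pos hx, p.parts_sum⟩
  · rintro ⟨h1, h2⟩
    exact ⟨⟨m, fun {i} hi ↦ h1 i hi, h2⟩, rfl⟩

variable {R : Type*} [CommRing R]

/-- The weight of a multiset: the product of `f i c` over its elements `i` of multiplicity `c`. -/
def weight (f : ℕ → ℕ → R) (m : Multiset ℕ) : R := ∏ i ∈ m.toFinset, f i (m.count i)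

theorem coeff_genFun_eq (f : ℕ → ℕ → R) (n : ℕ) :
    coeff n (Nat.Partition.genFun f) = ∑ m ∈ partitions n, weight f m := by
  rw [Nat.Partition.coeff_genFun, partitions, sum_image]
  · simp [Finsupp.prod, weight]
  · intro p _ p' _ h
    exact Nat.Partition.ext h

/-- Power series truncated at degree `N`. -/
noncomputable abbrev Trunc (R : Type*) [CommRing R] (N : ℕ) : Type _ :=
  R⟦X⟧ ⧸ Ideal.span {(X : R⟦X⟧) ^ N}

/-- The truncation map. -/
noncomputable abbrev toTrunc (N : ℕ) : R⟦X⟧ →+* Trunc R N := Ideal.Quotient.mk _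

/-- The variable of the ring of truncated power series. -/
noncomputable def var (R : Type*) [CommRing R] (N : ℕ) : Trunc R N := toTrunc N X

/-- The constants of the ring of truncated power series. -/
noncomputable def const (N : ℕ) : R →+* Trunc R N := (toTrunc N).comp C

theorem toTrunc_eq_iff {N : ℕ} {a b : R⟦X⟧} :
    toTrunc N a = toTrunc N b ↔ ∀ n < N, coeff n a = coeff n b := by
  rw [Ideal.Quotient.eq, Ideal.mem_span_singleton, X_pow_dvd_iff]
  simp [sub_eq_zero]

theorem var_pow_eq_zero {N k : ℕ} (h : N ≤ k) : var R N ^ k = 0 := by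
  rw [var, ← map_pow, ← map_zero (toTrunc N), toTrunc_eq_iff]
  intro n hn
  rw [coeff_X_pow, if_neg (by lia), map_zero]

open scoped PowerSeries.WithPiTopology in
/-- The product formula for `genFun`, truncated. -/
theorem toTrunc_genFun (f : ℕ → ℕ → R) {N K : ℕ} (h : N ≤ K) :
    toTrunc N (Nat.Partition.genFun f) = ∏ i ∈ range K,
      (1 + ∑ j ∈ range N, const N (f (i + 1) (j + 1)) * var R N ^ ((i + 1) * (j + 1))) := by
  let _ : TopologicalSpace R := ⊥
  have _ : DiscreteTopology R := ⟨rfl⟩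
  let F : ℕ → R⟦X⟧ := fun i ↦ 1 + ∑' j, f (i + 1) (j + 1) • X ^ ((i + 1) * (j + 1))
  have hF (i : ℕ) : toTrunc N (F i) =
      1 + ∑ j ∈ range N, const N (f (i + 1) (j + 1)) * var R N ^ ((i + 1) * (j + 1)) := by
    have : 1 + ∑ j ∈ range N, const N (f (i + 1) (j + 1)) * var R N ^ ((i + 1) * (j + 1)) =
        toTrunc N (1 + ∑ j ∈ range N, f (i + 1) (j + 1) • X ^ ((i + 1) * (j + 1))) := by
      simp [const, var, smul_eq_C_mul]
    rw [this, toTrunc_eq_iff]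
    intro n hn
    rw [map_add, map_add, (Nat.Partition.summable_genFun_term f i).map_tsum _
      (WithPiTopology.continuous_coeff _ _), map_sum]
    congr 1
    refine tsum_eq_sum fun j hj ↦ ?_
    rw [mem_range, not_lt] at hj
    rw [map_smul, coeff_X_pow, if_neg, smul_zero]
    nlinarith
  have hF1 (i : ℕ) (hi : N ≤ i) : toTrunc N (F i) = 1 := by
    rw [hF, sum_eq_zero, add_zero]
    intro j _
    rw [var_pow_eq_zero (by nlinarith), mul_zero]
  have hprod (k : ℕ) (hk : K ≤ k) :
      toTrunc N (∏ i ∈ range k, F i) = toTrunc N (∏ i ∈ range K, F i) := by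
    obtain ⟨l, rfl⟩ := Nat.exists_eq_add_of_le hk
    rw [prod_range_add, map_mul, map_prod _ _ (range l),
      prod_eq_one (s := range l) fun i _ ↦ hF1 _ (by lia), mul_one]
  have key : toTrunc N (Nat.Partition.genFun f) = toTrunc N (∏ i ∈ range K, F i) := by
    rw [toTrunc_eq_iff]
    intro n hn
    have h1 := (Nat.Partition.hasProd_genFun f).tendsto_prod_nat
    have h2 := ((WithPiTopology.continuous_coeff R n).tendsto _).comp h1
    refine tendsto_nhds_unique h2 (tendsto_const_nhds.congr' ?_)
    filter_upwards [Filter.eventually_ge_atTop K] with k hk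
    exact (toTrunc_eq_iff.1 (hprod k hk) n hn).symm
  rw [key, map_prod]
  exact prod_congr rfl fun i _ ↦ hF i

theorem prod_range_mul_eq {B : Type*} [CommMonoid B] {d r : ℕ} (hr : r < d) (φ : ℕ → B)
    (h : ∀ i, i % d ≠ r → φ i = 1) (n : ℕ) :
    ∏ i ∈ range (d * n), φ i = ∏ k ∈ range n, φ (d * k + r) := by
  induction n with
  | zero => simp
  | succ n ih =>
    rw [mul_add, mul_one, prod_range_add, ih, prod_range_succ]
    congr 1
    refine prod_eq_single r (fun i hi hir ↦ h _ ?_) (by simp [hr])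
    rwa [Nat.mul_add_mod, Nat.mod_eq_of_lt (mem_range.1 hi)]

/-- A sum over pairs, graded by the sum of the sizes, is a coefficient of a product. -/
theorem coeff_mul_eq_sum {α β : Type*} [DecidableEq α] [DecidableEq β] {F : ℕ → Finset α}
    {G : ℕ → Finset β} (s : α → ℕ) (t : β → ℕ) (hF : ∀ n, ∀ x ∈ F n, s x = n)
    (hG : ∀ n, ∀ x ∈ G n, t x = n) {φ : α → R} {ψ : β → R} {a b : R⟦X⟧}
    (ha : ∀ n, coeff n a = ∑ x ∈ F n, φ x) (hb : ∀ n, coeff n b = ∑ x ∈ G n, ψ x) (n : ℕ) :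
    coeff n (a * b) = ∑ p ∈ (antidiagonal n).biUnion (fun k ↦ F k.1 ×ˢ G k.2),
      φ p.1 * ψ p.2 := by
  rw [coeff_mul, sum_biUnion]
  · refine sum_congr rfl fun k _ ↦ ?_
    rw [ha, hb, sum_mul_sum, sum_product]
  · intro k _ l _ hkl
    rw [Function.onFun, disjoint_left]
    intro p hp hp'
    rw [mem_product] at hp hp'
    exact hkl (Prod.ext ((hF _ _ hp.1).symm.trans (hF _ _ hp'.1))
      ((hG _ _ hp.2).symm.trans (hG _ _ hp'.2)))

/-- The truncated geometric series `∑ q ^ (k e)`. -/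
def geom {A : Type*} [CommRing A] (M : ℕ) (q : A) (k : ℕ) : A := ∑ e ∈ range M, (q ^ k) ^ e

theorem geom_spec {A : Type*} [CommRing A] {M : ℕ} {q : A} (hq : q ^ M = 0) {k : ℕ}
    (hk : 1 ≤ k) : (1 - q ^ k) * geom M q k = 1 := by
  rw [geom, mul_neg_geom_sum, ← pow_mul, pow_eq_zero_of_le (by nlinarith) hq, sub_zero]

theorem sum_range_two_mul {B : Type*} [AddCommMonoid B] (f : ℕ → B) (n : ℕ) :
    ∑ i ∈ range (2 * n), f i = ∑ i ∈ range n, (f (2 * i) + f (2 * i + 1)) := by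
  induction n with
  | zero => simp
  | succ n ih => rw [mul_add, sum_range_succ, sum_range_succ, ih, sum_range_succ, add_assoc]

section Factors

variable {M : ℕ}

theorem var_sq_pow : (var R (2 * M) ^ 2) ^ M = 0 := by
  rw [← pow_mul]
  exact var_pow_eq_zero le_rfl

theorem factor_even {i : ℕ} (hi : 1 ≤ i) (z : R) :
    1 + ∑ j ∈ range (2 * M), const (2 * M) (if Even (j + 1) then 1 + z else 0) *
      var R (2 * M) ^ (i * (j + 1)) =
    (1 + const (2 * M) z * (var R (2 * M) ^ 2) ^ i) * geom M (var R (2 * M) ^ 2) i := by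
  have h1 : ∑ j ∈ range (2 * M), const (2 * M) (if Even (j + 1) then 1 + z else 0) *
      var R (2 * M) ^ (i * (j + 1)) =
      (1 + const (2 * M) z) * (var R (2 * M) ^ 2) ^ i * geom M (var R (2 * M) ^ 2) i := by
    rw [sum_range_two_mul, geom, mul_sum]
    refine sum_congr rfl fun e _ ↦ ?_
    rw [if_neg (by grind), if_pos (by grind)]
    simp only [map_zero, zero_mul, zero_add, map_add, map_one]
    ring
  rw [h1]
  linear_combination -geom_spec (var_sq_pow (R := R) (M := M)) hi

theorem factor_odd (m : ℕ) (z : R) :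
    ∑ j ∈ range (2 * M), const (2 * M) (if Odd (j + 1) then 1 + z else 0) *
      var R (2 * M) ^ (2 * m * (j + 1)) =
    (1 + const (2 * M) z) * (var R (2 * M) ^ 2) ^ m *
      geom M (var R (2 * M) ^ 2) (2 * m) := by
  rw [sum_range_two_mul, geom, mul_sum]
  refine sum_congr rfl fun e _ ↦ ?_
  rw [if_pos (by grind), if_neg (by grind)]
  simp only [map_zero, zero_mul, add_zero, map_add, map_one]
  ring

end Factors

/-- The local conditions describing members of `EO*` whose even parts are below `2 m` and whose
odd parts are above `2 m`. -/
def Below (m i c : ℕ) : Prop := ((Odd i ∧ 2 * m < i) ∨ (Even i ∧ i < 2 * m)) ∧ Even c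

/-- The local conditions describing members of `EO*` with even parts at most `2 m` and
odd parts above `2 m`, the part `2 m` being allowed an odd number of times. -/
def UpTo (m i c : ℕ) : Prop := Below m i c ∨ (i = 2 * m ∧ Odd c)

open scoped Classical in
/-- The weight `1 + z` for each distinct part subject to `P`. -/
noncomputable def markWeight (P : ℕ → ℕ → Prop) (z : R) (i c : ℕ) : R :=
  if P i c then 1 + z else 0

open scoped Classical in
theorem weight_markWeight (P : ℕ → ℕ → Prop) (z : R) (m : Multiset ℕ) :
    weight (markWeight P z) m =
      if ∀ i ∈ m, P i (m.count i) then (1 + z) ^ m.toFinset.card else 0 := by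
  simp only [weight, markWeight]
  split_ifs with h
  · rw [prod_congr rfl fun i hi ↦ if_pos (h i (Multiset.mem_toFinset.1 hi)), prod_const]
  · push Not at h
    obtain ⟨i, hi, hP⟩ := h
    exact prod_eq_zero (Multiset.mem_toFinset.2 hi) (if_neg hP)

theorem le_lep {m : Multiset ℕ} {x : ℕ} (hx : x ∈ m) (h : Even x) : x ≤ lep m :=
  Multiset.le_sup (Multiset.mem_filter.2 ⟨hx, h⟩)

theorem lep_eq_zero_or_mem (m : Multiset ℕ) : lep m = 0 ∨ lep m ∈ m ∧ Even (lep m) := by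
  unfold lep
  induction m using Multiset.induction_on with
  | empty => simp
  | cons a s ih =>
    by_cases ha : Even a
    · rw [Multiset.filter_cons_of_pos _ ha, Multiset.sup_cons]
      rcases le_total a (s.filter (fun x ↦ Even x)).sup with h | h
      · rw [sup_eq_right.2 h]
        exact ih.imp_right fun h ↦ ⟨Multiset.mem_cons_of_mem h.1, h.2⟩
      · rw [sup_eq_left.2 h]
        exact Or.inr ⟨Multiset.mem_cons_self _ _, ha⟩
    · rw [Multiset.filter_cons_of_neg _ ha]
      exact ih.imp_right fun h ↦ ⟨Multiset.mem_cons_of_mem h.1, h.2⟩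

theorem even_lep (m : Multiset ℕ) : Even (lep m) := by
  rcases lep_eq_zero_or_mem m with h | h
  · simp [h]
  · exact h.2

theorem lep_le_sum (m : Multiset ℕ) : lep m ≤ m.sum := by
  rcases lep_eq_zero_or_mem m with h | h
  · simp [h]
  · exact Multiset.single_le_sum (fun _ _ ↦ Nat.zero_le _) _ h.1

theorem forall_below_zero_iff {m : Multiset ℕ} (hm : IsPartition m) :
    (∀ i ∈ m, Below 0 i (m.count i)) ↔ EOStar m ∧ lep m = 0 := by
  constructor
  · intro h
    have h0 : lep m = 0 := by
      rcases lep_eq_zero_or_mem m with h' | h'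
      · exact h'
      · have := h _ h'.1
        grind [Below]
    refine ⟨⟨hm, ?_, ?_, ?_⟩, h0⟩
    · intro x hx y hy hxe
      have := h x hx
      grind [Below]
    · intro x hx _
      exact (h x hx).2
    · intro x hx hx0
      have := hm x hx
      lia
  · rintro ⟨⟨-, -, h2, -⟩, h0⟩ i hi
    have hpos := hm i hi
    refine ⟨Or.inl ⟨?_, by lia⟩, h2 i hi (by lia)⟩
    rw [← Nat.not_even_iff_odd]
    intro he
    have := le_lep hi he
    lia

theorem forall_upTo_iff {m : Multiset ℕ} (hm : IsPartition m) {k : ℕ} (hk : 0 < k) :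
    ((∀ i ∈ m, UpTo k i (m.count i)) ∧ ¬ ∀ i ∈ m, Below k i (m.count i)) ↔
      EOStar m ∧ lep m = 2 * k := by
  constructor
  · rintro ⟨h, h'⟩
    push Not at h'
    obtain ⟨i, hi, hib⟩ := h'
    have hi2 : i = 2 * k := by
      have := h i hi
      grind [UpTo]
    subst hi2
    have hle : ∀ x ∈ m, Even x → x ≤ 2 * k := by
      intro x hx hxe
      have := h x hx
      grind [UpTo, Below]
    have hl : lep m = 2 * k := by
      apply le_antisymm
      · rcases lep_eq_zero_or_mem m with h0 | h0
        · lia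
        · exact hle _ h0.1 h0.2
      · exact le_lep hi (by simp)
    refine ⟨⟨hm, ?_, ?_, ?_⟩, hl⟩
    · intro x hx y hy hxe hyo
      have h1 := hle x hx hxe
      have h2 := h y hy
      grind [UpTo, Below]
    · intro x hx hxl
      have := h x hx
      grind [UpTo, Below]
    · intro x hx hxl
      have := h x hx
      grind [UpTo, Below]
  · rintro ⟨⟨-, h1, h2, h3⟩, hl⟩
    have hmem : lep m ∈ m ∧ Even (lep m) := (lep_eq_zero_or_mem m).resolve_left (by lia)
    constructor
    · intro i hi
      by_cases hil : i = lep m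
      · exact Or.inr ⟨by lia, h3 i hi hil⟩
      · refine Or.inl ⟨?_, h2 i hi hil⟩
        rcases Nat.even_or_odd i with he | ho
        · have := le_lep hi he
          exact Or.inr ⟨he, by lia⟩
        · have := h1 _ hmem.1 i hi hmem.2 ho
          exact Or.inl ⟨ho, by lia⟩
    · intro h
      have := h _ hmem.1
      grind [Below]

theorem upTo_of_below {k i c : ℕ} (h : Below k i c) : UpTo k i c := Or.inl h

open scoped Classical in
/-- The signed weight of a multiset in `EO*`. -/
noncomputable def signedWeight (z : R) (m : Multiset ℕ) : R :=
  if EOStar m then (-1) ^ (lep m / 2) * (1 + z) ^ m.toFinset.card else 0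

theorem signedWeight_eq (z : R) {m : Multiset ℕ} (hm : IsPartition m) {K : ℕ}
    (hK : m.sum < 2 * (K + 1)) :
    signedWeight z m = ∑ k ∈ range K, (-1) ^ (k + 1) *
      (weight (markWeight (UpTo (k + 1)) z) m - weight (markWeight (Below (k + 1)) z) m) +
      weight (markWeight (Below 0) z) m := by
  classical
  have h0 : weight (markWeight (Below 0) z) m =
      if EOStar m ∧ lep m = 0 then (1 + z) ^ m.toFinset.card else 0 := by
    rw [weight_markWeight]
    exact if_congr (forall_below_zero_iff hm) rfl rfl
  have h1 (k : ℕ) : weight (markWeight (UpTo (k + 1)) z) m -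
      weight (markWeight (Below (k + 1)) z) m =
      if EOStar m ∧ lep m = 2 * (k + 1) then (1 + z) ^ m.toFinset.card else 0 := by
    rw [weight_markWeight, weight_markWeight, ← if_congr (forall_upTo_iff hm k.succ_pos) rfl rfl]
    by_cases ha : ∀ i ∈ m, Below (k + 1) i (m.count i)
    · have hb : ∀ i ∈ m, UpTo (k + 1) i (m.count i) := fun i hi ↦ upTo_of_below (ha i hi)
      rw [if_pos ha, if_pos hb, if_neg (fun h ↦ h.2 ha), sub_self]
    · simp [ha]
  simp only [h0, h1, signedWeight]
  by_cases he : EOStar m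
  swap
  · simp [he]
  obtain ⟨l, hl⟩ := even_lep m
  have hle := lep_le_sum m
  simp only [he, if_true, true_and]
  rcases l with - | l
  · rw [sum_eq_zero]
    · simp [hl]
    · intro k _
      rw [if_neg (by lia), mul_zero]
  · rw [if_neg (by lia), add_zero, sum_eq_single l]
    · rw [if_pos (by lia)]
      congr 2
      lia
    · intro k _ hkl
      rw [if_neg (by lia), mul_zero]
    · intro hlK
      rw [mem_range] at hlK
      lia

/-- The generating function of the signed weights. -/
noncomputable def signedGF (z : R) (K : ℕ) : R⟦X⟧ :=
  ∑ k ∈ range K, (-1) ^ (k + 1) * (Nat.Partition.genFun (markWeight (UpTo (k + 1)) z) -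
    Nat.Partition.genFun (markWeight (Below (k + 1)) z)) +
    Nat.Partition.genFun (markWeight (Below 0) z)

theorem coeff_signedGF (z : R) {K n : ℕ} (hn : n < 2 * (K + 1)) :
    coeff n (signedGF z K) = ∑ m ∈ partitions n, signedWeight z m := by
  have h (k : ℕ) (f : R⟦X⟧) : coeff n ((-1) ^ k * f) = (-1) ^ k * coeff n f := by
    rw [show ((-1 : R⟦X⟧)) ^ k = C ((-1) ^ k) by simp, coeff_C_mul]
  simp only [signedGF, map_add, map_sum, h, map_sub, coeff_genFun_eq]
  rw [sum_congr rfl fun m hm ↦ signedWeight_eq z (mem_partitions.1 hm).1 (K := K)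
    (by rw [(mem_partitions.1 hm).2]; exact hn), sum_add_distrib, sum_comm]
  simp only [mul_sum, sum_sub_distrib, mul_sub]

section Products

variable {M : ℕ}

open scoped Classical in
theorem factor_of_even {P : ℕ → ℕ → Prop} {i : ℕ} (hi : 1 ≤ i) (z : R)
    (h : ∀ c, P i c ↔ Even c) :
    1 + ∑ j ∈ range (2 * M), const (2 * M) (markWeight P z i (j + 1)) *
      var R (2 * M) ^ (i * (j + 1)) =
    (1 + const (2 * M) z * (var R (2 * M) ^ 2) ^ i) * geom M (var R (2 * M) ^ 2) i := by
  rw [← factor_even hi]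
  simp only [markWeight, h]

theorem factor_of_odd {P : ℕ → ℕ → Prop} {m : ℕ} (z : R) (h : ∀ c, P (2 * m) c ↔ Odd c) :
    1 + ∑ j ∈ range (2 * M), const (2 * M) (markWeight P z (2 * m) (j + 1)) *
      var R (2 * M) ^ (2 * m * (j + 1)) =
    1 + (1 + const (2 * M) z) * (var R (2 * M) ^ 2) ^ m *
      geom M (var R (2 * M) ^ 2) (2 * m) := by
  rw [← factor_odd]
  simp only [markWeight, h]

theorem factor_of_false {P : ℕ → ℕ → Prop} {i : ℕ} (z : R) (h : ∀ c, ¬ P i c) :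
    1 + ∑ j ∈ range (2 * M), const (2 * M) (markWeight P z i (j + 1)) *
      var R (2 * M) ^ (i * (j + 1)) = 1 := by
  simp [markWeight, h]

/-- The factors of the generating function attached to the odd parts. -/
theorem prod_odd {P : ℕ → ℕ → Prop} {m : ℕ} (z : R) (hm : m ≤ M)
    (h : ∀ i c, Odd i → (P i c ↔ 2 * m < i ∧ Even c)) :
    ∏ k ∈ range M, (1 + ∑ j ∈ range (2 * M), const (2 * M) (markWeight P z (2 * k + 1) (j + 1)) *
      var R (2 * M) ^ ((2 * k + 1) * (j + 1))) =
    BaileyDaum.oddTail M (var R (2 * M) ^ 2) (const (2 * M) z) m *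
      BaileyDaum.oddTailInv M (geom M (var R (2 * M) ^ 2)) m := by
  have hx : (var R (2 * M) ^ 2) ^ M = 0 := var_sq_pow
  rw [BaileyDaum.oddTail, BaileyDaum.oddTailInv, ← prod_mul_distrib]
  obtain ⟨l, hl⟩ := Nat.exists_eq_add_of_le hm
  have e1 : range M = range (m + l) := by rw [hl]
  have e2 : range M = range (l + m) := by rw [hl, add_comm]
  conv_rhs => rw [e2, prod_range_add]
  conv_lhs => rw [e1, prod_range_add]
  rw [prod_eq_one (s := range m), one_mul, prod_eq_one (s := range m), mul_one]
  · refine prod_congr rfl fun k _ ↦ factor_of_even (by lia) z fun c ↦ ?_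
    rw [h _ _ (by simp)]
    simp only [and_iff_right_iff_imp]
    lia
  · intro k _
    rw [BaileyDaum.inv_eq_one hx (fun k hk ↦ geom_spec hx hk) (by lia) (by lia),
      pow_eq_zero_of_le (n := 2 * (m + (l + k)) + 1) (by lia) hx]
    simp
  · intro k hk
    rw [mem_range] at hk
    refine factor_of_false z fun c ↦ ?_
    rw [h _ _ (by simp)]
    lia

theorem toTrunc_markWeight {P : ℕ → ℕ → Prop} {m : ℕ} (z : R) (hm : m ≤ M)
    (h : ∀ i c, Odd i → (P i c ↔ 2 * m < i ∧ Even c)) :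
    toTrunc (2 * M) (Nat.Partition.genFun (markWeight P z)) =
      BaileyDaum.oddTail M (var R (2 * M) ^ 2) (const (2 * M) z) m *
      BaileyDaum.oddTailInv M (geom M (var R (2 * M) ^ 2)) m *
      ∏ k ∈ range M, (1 + ∑ j ∈ range (2 * M),
        const (2 * M) (markWeight P z (2 * k + 2) (j + 1)) *
          var R (2 * M) ^ ((2 * k + 2) * (j + 1))) := by
  rw [toTrunc_genFun _ le_rfl, BaileyDaum.prod_range_two_mul, prod_mul_distrib, prod_odd z hm h]

theorem toTrunc_below_zero (z : R) :
    toTrunc (2 * M) (Nat.Partition.genFun (markWeight (Below 0) z)) =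
      BaileyDaum.term M (var R (2 * M) ^ 2) (geom M (var R (2 * M) ^ 2)) (const (2 * M) z) 0 := by
  rw [toTrunc_markWeight (m := 0) z (Nat.zero_le _), prod_eq_one]
  · simp [BaileyDaum.term]
  · intro k _
    exact factor_of_false z fun c ↦ by grind [Below]
  · grind [Below]

theorem toTrunc_upTo_sub_below (z : R) {m : ℕ} (hm : m + 1 ≤ M) :
    (-1) ^ (m + 1) * (toTrunc (2 * M) (Nat.Partition.genFun (markWeight (UpTo (m + 1)) z)) -
      toTrunc (2 * M) (Nat.Partition.genFun (markWeight (Below (m + 1)) z))) =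
    BaileyDaum.term M (var R (2 * M) ^ 2) (geom M (var R (2 * M) ^ 2)) (const (2 * M) z)
      (m + 1) := by
  have hsplit (P : ℕ → ℕ → Prop) (hlt : ∀ k < m, ∀ c, P (2 * k + 2) c ↔ Even c)
      (hgt : ∀ k, m < k → ∀ c, ¬ P (2 * k + 2) c) :
      ∏ k ∈ range M, (1 + ∑ j ∈ range (2 * M),
        const (2 * M) (markWeight P z (2 * k + 2) (j + 1)) *
          var R (2 * M) ^ ((2 * k + 2) * (j + 1))) =
      (∏ k ∈ range m, ((1 + const (2 * M) z * (var R (2 * M) ^ 2) ^ (2 * k + 2)) *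
        geom M (var R (2 * M) ^ 2) (2 * k + 2))) *
      (1 + ∑ j ∈ range (2 * M), const (2 * M) (markWeight P z (2 * (m + 1)) (j + 1)) *
          var R (2 * M) ^ (2 * (m + 1) * (j + 1))) := by
    rw [← prod_subset (range_subset_range.2 hm), prod_range_succ]
    · congr 1
      refine prod_congr rfl fun k hk ↦ factor_of_even (by lia) z (hlt k (mem_range.1 hk))
    · intro k _ hk
      rw [mem_range] at hk
      exact factor_of_false z (hgt k (by lia))
  rw [toTrunc_markWeight (m := m + 1) z hm (by grind [UpTo, Below]),
    toTrunc_markWeight (m := m + 1) z hm (by grind [Below]),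
    hsplit (UpTo (m + 1)) (by grind [UpTo, Below]) (by grind [UpTo, Below]),
    hsplit (Below (m + 1)) (by grind [Below]) (by grind [Below]),
    factor_of_odd z (by grind [UpTo, Below]), factor_of_false z (by grind [Below]),
    BaileyDaum.term_succ, prod_mul_distrib, mul_one]

theorem toTrunc_signedGF (z : R) {K : ℕ} :
    toTrunc (2 * (K + 1)) (signedGF z K) =
      BaileyDaum.series (K + 1) (var R (2 * (K + 1)) ^ 2)
        (geom (K + 1) (var R (2 * (K + 1)) ^ 2)) (const (2 * (K + 1)) z) := by
  rw [BaileyDaum.series, sum_range_succ', signedGF, map_add, map_sum, toTrunc_below_zero]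
  congr 1
  refine sum_congr rfl fun k hk ↦ ?_
  rw [← toTrunc_upTo_sub_below z (by grind)]
  simp

end Products

/-- The weight `w` for each part, all parts being distinct and satisfying `P`. -/
def distinctWeight (P : ℕ → Prop) [DecidablePred P] (w : R) (i c : ℕ) : R :=
  if P i ∧ c = 1 then w else 0

/-- The indicator weight of the multisets whose parts all satisfy `P`. -/
def allWeight (P : ℕ → Prop) [DecidablePred P] (i _c : ℕ) : R := if P i then 1 else 0

theorem weight_distinctWeight (P : ℕ → Prop) [DecidablePred P] (w : R) (m : Multiset ℕ) :
    weight (distinctWeight P w) m =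
      if m.Nodup ∧ ∀ x ∈ m, P x then w ^ Multiset.card m else 0 := by
  simp only [weight, distinctWeight]
  split_ifs with h
  · rw [← Multiset.toFinset_card_of_nodup h.1, ← prod_const]
    refine prod_congr rfl fun i hi ↦ if_pos ?_
    rw [Multiset.mem_toFinset] at hi
    exact ⟨h.2 i hi, Multiset.count_eq_one_of_mem h.1 hi⟩
  · contrapose! h
    have h' : ∀ i ∈ m, P i ∧ m.count i = 1 := by
      intro i hi
      by_contra hi'
      exact h (prod_eq_zero (Multiset.mem_toFinset.2 hi) (if_neg hi'))
    refine ⟨Multiset.nodup_iff_count_le_one.2 fun i ↦ ?_, fun i hi ↦ (h' i hi).1⟩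
    by_cases hi : i ∈ m
    · exact (h' i hi).2.le
    · simp [hi]

theorem weight_allWeight (P : ℕ → Prop) [DecidablePred P] (m : Multiset ℕ) :
    weight (allWeight P : ℕ → ℕ → R) m = if ∀ x ∈ m, P x then 1 else 0 := by
  simp only [weight, allWeight]
  rw [prod_ite_zero]
  simp

theorem toTrunc_distinctWeight (P : ℕ → Prop) [DecidablePred P] (w : R) {N K : ℕ} (h : N ≤ K)
    (hN : 0 < N) :
    toTrunc N (Nat.Partition.genFun (distinctWeight P w)) =
      ∏ i ∈ range K, if P (i + 1) then 1 + const N w * var R N ^ (i + 1) else 1 := by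
  rw [toTrunc_genFun _ h]
  refine prod_congr rfl fun i _ ↦ ?_
  rw [sum_eq_single_of_mem 0 (mem_range.2 hN)]
  · by_cases hP : P (i + 1) <;> simp [distinctWeight, hP]
  · intro j _ hj
    simp [distinctWeight, hj]

theorem toTrunc_allWeight (P : ℕ → Prop) [DecidablePred P] {N K : ℕ} (h : N ≤ K) :
    toTrunc N (Nat.Partition.genFun (allWeight P : ℕ → ℕ → R)) =
      ∏ i ∈ range K, if P (i + 1) then 1 + ∑ j ∈ range N, var R N ^ ((i + 1) * (j + 1)) else 1 := by
  rw [toTrunc_genFun _ h]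
  refine prod_congr rfl fun i _ ↦ ?_
  by_cases hP : P (i + 1) <;> simp [allWeight, hP]

/-- The generating function of the quadruples. -/
noncomputable def quadGF (z : R) : R⟦X⟧ :=
  (Nat.Partition.genFun (distinctWeight (4 ∣ ·) 1) *
      Nat.Partition.genFun (distinctWeight (· % 8 = 4) z)) *
    (Nat.Partition.genFun (distinctWeight (· % 8 = 4) z) *
      Nat.Partition.genFun (allWeight (· % 8 = 4)))

theorem toTrunc_quadGF (z : R) {L : ℕ} (hL : 0 < L) :
    toTrunc (2 * (4 * L)) (quadGF z) =
      BaileyDaum.series (4 * L) (var R (2 * (4 * L)) ^ 2)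
        (geom (4 * L) (var R (2 * (4 * L)) ^ 2)) (const (2 * (4 * L)) z) := by
  have hx : (var R (2 * (4 * L)) ^ 2) ^ (4 * L) = 0 := var_sq_pow
  rw [BaileyDaum.series_eq hL.ne' hx fun k hk ↦ geom_spec hx hk]
  have ha : toTrunc (2 * (4 * L)) (Nat.Partition.genFun (distinctWeight (4 ∣ ·) (1 : R))) =
      ∏ i ∈ range (2 * L), (1 + (var R (2 * (4 * L)) ^ 2) ^ (2 * i + 2)) := by
    rw [toTrunc_distinctWeight _ _ (K := 4 * (2 * L)) (by lia) (by lia),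
      prod_range_mul_eq (r := 3) (by lia)]
    · refine prod_congr rfl fun i _ ↦ ?_
      rw [if_pos (by lia), map_one]
      ring
    · intro i hi
      rw [if_neg (by lia)]
  have hb : toTrunc (2 * (4 * L)) (Nat.Partition.genFun (distinctWeight (· % 8 = 4) z)) =
      ∏ i ∈ range L, (1 + const (2 * (4 * L)) z * (var R (2 * (4 * L)) ^ 2) ^ (4 * i + 2)) := by
    rw [toTrunc_distinctWeight _ _ (K := 8 * L) (by lia) (by lia),
      prod_range_mul_eq (r := 3) (by lia)]
    · refine prod_congr rfl fun i _ ↦ ?_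
      rw [if_pos (by lia)]
      ring
    · intro i hi
      rw [if_neg (by lia)]
  have hd : toTrunc (2 * (4 * L))
      (Nat.Partition.genFun (allWeight (· % 8 = 4) : ℕ → ℕ → R)) =
      ∏ i ∈ range L, geom (4 * L) (var R (2 * (4 * L)) ^ 2) (4 * i + 2) := by
    rw [toTrunc_allWeight _ (K := 8 * L) (by lia), prod_range_mul_eq (r := 3) (by lia)]
    · refine prod_congr rfl fun i _ ↦ ?_
      rw [if_pos (by lia)]
      have h1 := geom_spec hx (k := 4 * i + 2) (by lia)
      have h2 := mul_neg_geom_sum (var R (2 * (4 * L)) ^ (8 * i + 3 + 1)) (2 * (4 * L) + 1)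
      have h3 : (var R (2 * (4 * L)) ^ (8 * i + 3 + 1)) ^ (2 * (4 * L) + 1) = 0 := by
        rw [← pow_mul]
        exact var_pow_eq_zero (by nlinarith)
      rw [sum_range_succ', h3, pow_zero, sub_zero] at h2
      rw [← pow_mul, show 2 * (4 * i + 2) = 8 * i + 3 + 1 by lia] at h1
      simp only [pow_mul _ (8 * i + 3 + 1)]
      linear_combination geom (4 * L) (var R (2 * (4 * L)) ^ 2) (4 * i + 2) * h2 -
        (1 + ∑ j ∈ range (2 * (4 * L)), (var R (2 * (4 * L)) ^ (8 * i + 3 + 1)) ^ (j + 1)) * h1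
    · intro i hi
      rw [if_neg (by lia)]
  rw [quadGF, map_mul, map_mul, map_mul, ha, hb, hd]
  ring

/-- The pairs of partitions of total size `n`. -/
def pairs (n : ℕ) : Finset (Multiset ℕ × Multiset ℕ) :=
  (antidiagonal n).biUnion fun k ↦ partitions k.1 ×ˢ partitions k.2

theorem mem_pairs {n : ℕ} {p : Multiset ℕ × Multiset ℕ} :
    p ∈ pairs n ↔ IsPartition p.1 ∧ IsPartition p.2 ∧ p.1.sum + p.2.sum = n := by
  simp only [pairs, mem_biUnion, mem_product, mem_partitions, HasAntidiagonal.mem_antidiagonal,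
    Prod.exists]
  grind

/-- The quadruples of partitions of total size `n`. -/
def quads (n : ℕ) : Finset ((Multiset ℕ × Multiset ℕ) × (Multiset ℕ × Multiset ℕ)) :=
  (antidiagonal n).biUnion fun k ↦ pairs k.1 ×ˢ pairs k.2

theorem mem_quads {n : ℕ} {q : (Multiset ℕ × Multiset ℕ) × (Multiset ℕ × Multiset ℕ)} :
    q ∈ quads n ↔ (IsPartition q.1.1 ∧ IsPartition q.1.2 ∧ IsPartition q.2.1 ∧
      IsPartition q.2.2) ∧ q.1.1.sum + q.1.2.sum + q.2.1.sum + q.2.2.sum = n := by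
  simp only [quads, mem_biUnion, mem_product, mem_pairs, HasAntidiagonal.mem_antidiagonal,
    Prod.exists]
  constructor
  · rintro ⟨a, b, h, ⟨h1, h2, h3⟩, h4, h5, h6⟩
    exact ⟨⟨h1, h2, h4, h5⟩, by lia⟩
  · rintro ⟨⟨h1, h2, h3, h4⟩, h5⟩
    exact ⟨_, _, by lia, ⟨h1, h2, rfl⟩, h3, h4, rfl⟩

/-- The conditions on the quadruples `(α, β, γ, δ)`, except for sizes. -/
def IsQuad (q : (Multiset ℕ × Multiset ℕ) × (Multiset ℕ × Multiset ℕ)) : Prop :=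
  ((q.1.1.Nodup ∧ ∀ x ∈ q.1.1, 4 ∣ x) ∧ (q.1.2.Nodup ∧ ∀ x ∈ q.1.2, x % 8 = 4)) ∧
    (q.2.1.Nodup ∧ ∀ x ∈ q.2.1, x % 8 = 4) ∧ ∀ x ∈ q.2.2, x % 8 = 4

open scoped Classical in
theorem coeff_quadGF (z : R) (n : ℕ) :
    coeff n (quadGF z) = ∑ q ∈ quads n,
      if IsQuad q then z ^ (Multiset.card q.1.2 + Multiset.card q.2.1) else 0 := by
  have hs : ∀ n, ∀ m ∈ partitions n, m.sum = n := fun n m hm ↦ (mem_partitions.1 hm).2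
  have hp : ∀ n, ∀ p ∈ pairs n, p.1.sum + p.2.sum = n := fun n p hp ↦ (mem_pairs.1 hp).2.2
  rw [quadGF, coeff_mul_eq_sum (F := pairs) (G := pairs) _ _ hp hp
    (coeff_mul_eq_sum _ _ hs hs (coeff_genFun_eq _) (coeff_genFun_eq _))
    (coeff_mul_eq_sum _ _ hs hs (coeff_genFun_eq _) (coeff_genFun_eq _)), ← quads]
  refine sum_congr (by congr!) fun q _ ↦ ?_
  simp only [weight_distinctWeight, weight_allWeight, IsQuad, pow_add, one_pow]
  grind

/-- Multisets `m` of size `n` together with a subset of the distinct elements. -/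
def overpartitions (n : ℕ) : Finset (Multiset ℕ × Finset ℕ) :=
  (partitions n ×ˢ (range (n + 1)).powerset).filter fun p ↦ p.2 ⊆ p.1.toFinset

theorem mem_overpartitions {n : ℕ} {p : Multiset ℕ × Finset ℕ} :
    p ∈ overpartitions n ↔ IsOverpartition p ∧ p.1.sum = n := by
  simp only [overpartitions, mem_filter, mem_product, mem_partitions, mem_powerset,
    IsOverpartition]
  constructor
  · tauto
  · rintro ⟨⟨h1, h2⟩, h3⟩
    refine ⟨⟨⟨h1, h3⟩, fun x hx ↦ ?_⟩, h2⟩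
    have := Multiset.single_le_sum (fun _ _ ↦ Nat.zero_le _) _ (Multiset.mem_toFinset.1 (h2 hx))
    rw [mem_range]
    lia

theorem overEOStar_iff (p : Multiset ℕ × Finset ℕ) :
    OverEOStar p ↔ IsOverpartition p ∧ EOStar p.1 := by
  simp only [OverEOStar, EOStar, IsOverpartition]
  tauto

open scoped Classical in
theorem sum_overpartitions (z : R) (n : ℕ) :
    ∑ p ∈ overpartitions n, (if EOStar p.1 then (-1) ^ (lep p.1 / 2) * z ^ p.2.card else 0) =
      ∑ m ∈ partitions n, signedWeight z m := by
  rw [overpartitions, sum_filter, sum_product]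
  refine sum_congr rfl fun m hm ↦ ?_
  have hsub : m.toFinset ⊆ range (n + 1) := by
    intro x hx
    have := Multiset.single_le_sum (fun _ _ ↦ Nat.zero_le _) _ (Multiset.mem_toFinset.1 hx)
    rw [(mem_partitions.1 hm).2] at this
    rw [mem_range]
    lia
  rw [← sum_filter]
  have : (range (n + 1)).powerset.filter (fun s ↦ s ⊆ m.toFinset) = m.toFinset.powerset := by
    ext s
    simp only [mem_filter, mem_powerset]
    exact ⟨fun h ↦ h.2, fun h ↦ ⟨h.trans hsub, h⟩⟩
  simp only [this, signedWeight]
  split_ifs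
  · rw [← mul_sum, add_comm, ← sum_pow_mul_eq_add_pow]
    simp
  · simp

/-- The weighted identity at the level of coefficients of `q`. -/
theorem sum_signedWeight_eq (z : R) (n : ℕ) :
    ∑ m ∈ partitions n, signedWeight z m = coeff n (quadGF z) := by
  rw [← coeff_signedGF z (K := 4 * n + 3) (by lia)]
  refine (toTrunc_eq_iff (N := 2 * (4 * (n + 1)))).1 ?_ n (by lia)
  rw [toTrunc_quadGF z n.succ_pos]
  exact toTrunc_signedGF z (K := 4 * n + 3)

end PartitionGF

open PartitionGF in
/-- Coefficient-wise form of the weighted identity (4): for every positive integer `n` and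
nonnegative integer `j`, the sum of `w(π)` over overpartitions `π ∈ EO̅*` of `n` with
`j` overlined parts — i.e. the number of those whose largest even part is divisible by `4`
minus the number of those whose largest even part is not — equals the number of quadruples
`(α, β, γ, δ)` of partitions with `|α| + |β| + |γ| + |δ| = n`, where `α` has distinct
parts divisible by `4`, `β` and `γ` have distinct parts `≡ 4 (mod 8)` with
`ℓ(β) + ℓ(γ) = j`, and all parts of `δ` are `≡ 4 (mod 8)`. -/
theorem stmt10 (n : ℕ) (hn : 0 < n) (j : ℕ) :
    ({p : Multiset ℕ × Finset ℕ |
        OverEOStar p ∧ p.1.sum = n ∧ p.2.card = j ∧ 4 ∣ lep p.1}.ncard : ℤ) -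
    ({p : Multiset ℕ × Finset ℕ |
        OverEOStar p ∧ p.1.sum = n ∧ p.2.card = j ∧ ¬ 4 ∣ lep p.1}.ncard : ℤ) =
    ({q : (Multiset ℕ × Multiset ℕ) × (Multiset ℕ × Multiset ℕ) |
        IsPartition q.1.1 ∧ q.1.1.Nodup ∧ (∀ x ∈ q.1.1, 4 ∣ x) ∧
        q.1.2.Nodup ∧ (∀ x ∈ q.1.2, x % 8 = 4) ∧
        q.2.1.Nodup ∧ (∀ x ∈ q.2.1, x % 8 = 4) ∧
        Multiset.card q.1.2 + Multiset.card q.2.1 = j ∧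
        (∀ x ∈ q.2.2, x % 8 = 4) ∧
        q.1.1.sum + q.1.2.sum + q.2.1.sum + q.2.2.sum = n}.ncard : ℤ) := by
  classical
  have key := (sum_overpartitions (Polynomial.X : Polynomial ℤ) n).trans
    ((sum_signedWeight_eq _ n).trans (coeff_quadGF _ n))
  have key := congrArg (Polynomial.coeff · j) key
  simp only [Polynomial.finsetSum_coeff] at key
  have hpos : ∀ m : Multiset ℕ, (∀ x ∈ m, x % 8 = 4) → IsPartition m := by
    intro m hm x hx
    have := hm x hx
    lia
  have hq : {q : (Multiset ℕ × Multiset ℕ) × (Multiset ℕ × Multiset ℕ) |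
        IsPartition q.1.1 ∧ q.1.1.Nodup ∧ (∀ x ∈ q.1.1, 4 ∣ x) ∧
        q.1.2.Nodup ∧ (∀ x ∈ q.1.2, x % 8 = 4) ∧
        q.2.1.Nodup ∧ (∀ x ∈ q.2.1, x % 8 = 4) ∧
        Multiset.card q.1.2 + Multiset.card q.2.1 = j ∧
        (∀ x ∈ q.2.2, x % 8 = 4) ∧
        q.1.1.sum + q.1.2.sum + q.2.1.sum + q.2.2.sum = n} =
      ((quads n).filter fun q ↦ IsQuad q ∧
        Multiset.card q.1.2 + Multiset.card q.2.1 = j : Finset _) := by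
    ext q
    rw [Finset.mem_coe, Finset.mem_filter, mem_quads, IsQuad]
    constructor
    · rintro ⟨h1, h2, h3, h4, h5, h6, h7, h8, h9, h10⟩
      exact ⟨⟨⟨h1, hpos _ h5, hpos _ h7, hpos _ h9⟩, h10⟩, ⟨⟨⟨h2, h3⟩, h4, h5⟩, ⟨h6, h7⟩, h9⟩, h8⟩
    · rintro ⟨⟨⟨h1, -⟩, h10⟩, ⟨⟨⟨h2, h3⟩, h4, h5⟩, ⟨h6, h7⟩, h9⟩, h8⟩
      exact ⟨h1, h2, h3, h4, h5, h6, h7, h8, h9, h10⟩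
  have hp (P : Multiset ℕ → Prop) : {p : Multiset ℕ × Finset ℕ |
        OverEOStar p ∧ p.1.sum = n ∧ p.2.card = j ∧ P p.1} =
      ((overpartitions n).filter fun p ↦ EOStar p.1 ∧ p.2.card = j ∧ P p.1 : Finset _) := by
    ext p
    rw [Finset.mem_coe, Finset.mem_filter, mem_overpartitions, Set.mem_ofPred_eq, overEOStar_iff]
    tauto
  rw [hq, hp (4 ∣ lep ·), hp (¬ 4 ∣ lep ·), Set.ncard_coe_finset, Set.ncard_coe_finset,
    Set.ncard_coe_finset, Finset.card_filter, Finset.card_filter, Finset.card_filter]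
  push_cast
  rw [← Finset.sum_sub_distrib]
  refine Eq.trans (Finset.sum_congr rfl fun p _ ↦ ?_) (key.trans (Finset.sum_congr rfl
    fun q _ ↦ ?_))
  · have hc : ((-1 : Polynomial ℤ) ^ (lep p.1 / 2) * Polynomial.X ^ p.2.card).coeff j =
        if p.2.card = j then (-1) ^ (lep p.1 / 2) else 0 := by
      rw [show (-1 : Polynomial ℤ) ^ (lep p.1 / 2) = Polynomial.C ((-1) ^ (lep p.1 / 2)) by simp,
        Polynomial.coeff_C_mul, Polynomial.coeff_X_pow]
      simp [eq_comm]
    by_cases he : EOStar p.1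
    swap
    · simp [he]
    by_cases hj : p.2.card = j
    swap
    · simp [he, hj, hc]
    rw [if_pos he, hc]
    obtain ⟨l, hl⟩ := even_lep p.1
    by_cases h4 : 4 ∣ lep p.1
    · have : Even (lep p.1 / 2) := by grind
      simp [he, hj, h4, this.neg_one_pow]
    · have : Odd (lep p.1 / 2) := by grind
      simp [he, hj, h4, this.neg_one_pow]
  · by_cases h : IsQuad q
    · simp [h, Polynomial.coeff_X_pow, eq_comm]
    · simp [h]
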